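/- Let T be a triangulated category with metric {B_n} and improvement {C_n}. Then {C_n} is, up to equivalence of metrics, the coarsest good metric that is finer than {B_n}: any good metric {A_n} that is finer than {B_n} is also finer than {C_n}. -/

import Mathlib

open CategoryTheory Limits Pretriangulated ZeroObject

universe v u

section Defs

variable {C : Type u} [Category.{v} C] [Preadditive C] [HasZeroObject C]
  [HasShift C ℤ] [∀ n : ℤ, (shiftFunctor C n).Additive] [Pretriangulated C]

/-- A metric on a triangulated category: a non-increasing chain of full
(iso-closed) subcategories containing `0` and closed under extensions. -/
structure IsMetric (B : ℕ → Set C) : Prop where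
  antitone : ∀ n : ℕ, B (n + 1) ⊆ B n
  zero_mem : ∀ n : ℕ, (0 : C) ∈ B n
  iso_closed : ∀ n : ℕ, ∀ ⦃X Y : C⦄, (X ≅ Y) → X ∈ B n → Y ∈ B n
  ext_closed : ∀ n : ℕ, ∀ T : Triangle C, T ∈ (distTriang C) →
    T.obj₁ ∈ B n → T.obj₃ ∈ B n → T.obj₂ ∈ B n

/-- The rapid decrease condition: `Σ⁻¹B_{n+1} ∪ B_{n+1} ∪ ΣB_{n+1} ⊆ B_n`. -/
def IsGoodMetric (B : ℕ → Set C) : Prop :=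
  ∀ n : ℕ, ∀ X ∈ B (n + 1),
    X ∈ B n ∧ X⟦(1 : ℤ)⟧ ∈ B n ∧ X⟦(-1 : ℤ)⟧ ∈ B n

/-- The improvement of a metric `{B n}`: `C 0 = B 0` and
`C (n+1) = B (n+1) ∩ Σ C n ∩ Σ⁻¹ C n`. -/
def improv (B : ℕ → Set C) : ℕ → Set C
  | 0 => B 0
  | n + 1 => B (n + 1) ∩ {X : C | X⟦(-1 : ℤ)⟧ ∈ improv B n}
      ∩ {X : C | X⟦(1 : ℤ)⟧ ∈ improv B n}

/-- `{A n}` is finer than `{B n}` if every ball of `B` contains a ball of `A`. -/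
def Finer (A B : ℕ → Set C) : Prop := ∀ n : ℕ, ∃ m : ℕ, A m ⊆ B n

/-- the improvement of `{B n}` is the coarsest good metric finer
than `{B n}`: any good metric `{A n}` finer than `{B n}` is finer than the
improvement of `{B n}`. -/
theorem finer_improv_of_good (B A : ℕ → Set C) (hB : IsMetric B)
    (hA : IsMetric A) (hAgood : IsGoodMetric A) (h : Finer A B) :
    Finer A (improv B) := by
  have hanti : Antitone A := antitone_nat_of_succ_le hA.antitone
  intro n
  induction n with
  | zero => exact h 0
  | succ n ih =>
    obtain ⟨m, hm⟩ := ih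
    obtain ⟨k, hk⟩ := h (n + 1)
    refine ⟨max k (m + 1), fun X hX => ?_⟩
    obtain ⟨-, hpos, hneg⟩ := hAgood m X (hanti (le_max_right k (m + 1)) hX)
    exact ⟨⟨hk (hanti (le_max_left k (m + 1)) hX), hm hneg⟩, hm hpos⟩

end Defs
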